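/- arXiv:1803.02971 — 2 statements merged into one kernel-verified Lean document; each statement's English description precedes it below -/
import Mathlib

section
/- Let Ω ⊂ ℝ^N (N ≥ 2) be a bounded domain, R = sup_{x∈Ω} |x|, a ≥ 1, A a real N×N symmetric positive semi-definite matrix, and dμ_A = ρ_A(x)dx with ρ_A(x) = c·exp(−(1/N)(xᵀAx)^{N/2}). Then for every u ∈ C_c^1(Ω), ((N−1)/N)^N ∫_Ω |u|^N / (|x|^N (log(aR/|x|))^N) dμ_A ≤ ∫_Ω |∇u · x/|x||^N dμ_A + ((N−1)/N)^{N−1} ∫_Ω |u|^N (xᵀAx)^{N/2} / (|x|^N (log(aR/|x|))^{N−1}) dμ_A. -/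
open MeasureTheory Real

theorem integral_eq_integral_sphere_integral_Ioi {E : Type*} [NormedAddCommGroup E]
    [NormedSpace ℝ E] [FiniteDimensional ℝ E] [Nontrivial E] [MeasurableSpace E] [BorelSpace E]
    (μ : Measure E) [μ.IsAddHaarMeasure] {F : E → ℝ} (hF : Integrable F μ) :
    ∫ x, F x ∂μ = ∫ ω : Metric.sphere (0 : E) 1, ∫ r in Set.Ioi (0 : ℝ),
      r ^ (Module.finrank ℝ E - 1) * F (r • (ω : E)) ∂volume ∂μ.toSphere := by
  set d := Module.finrank ℝ E
  set e := homeomorphUnitSphereProd E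
  set G : Metric.sphere (0 : E) 1 × Set.Ioi (0 : ℝ) → ℝ := fun p => F (p.2.1 • (p.1 : E))
  have hG : ∀ x, G (e x) = F x := fun x => by
    change F ((e.symm (e x) : ({0}ᶜ : Set E)) : E) = F x
    rw [e.symm_apply_apply]
  have hmp := μ.measurePreserving_homeomorphUnitSphereProd
  have hint : Integrable G (μ.toSphere.prod (.volumeIoiPow (d - 1))) := by
    rw [← hmp.integrable_comp_emb (Homeomorph.measurableEmbedding _)]
    have h : Integrable (fun x : ({0}ᶜ : Set E) => F x) (μ.comap (↑)) :=
      (integrableOn_iff_comap_subtypeVal (measurableSet_singleton _).compl).1 hF.integrableOn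
    exact h.congr (.of_forall fun x => (hG x).symm)
  calc
    ∫ x, F x ∂μ = ∫ x : ({(0)}ᶜ : Set E), F x ∂(μ.comap (↑)) := by
      rw [integral_subtype_comap (measurableSet_singleton _).compl F,
        restrict_compl_singleton]
    _ = ∫ p, G p ∂μ.toSphere.prod (.volumeIoiPow (d - 1)) := by
      rw [← hmp.integral_comp (Homeomorph.measurableEmbedding _) G]
      exact integral_congr_ae (.of_forall fun x => (hG x).symm)
    _ = ∫ ω, ∫ r, G (ω, r) ∂(.volumeIoiPow (d - 1)) ∂μ.toSphere := integral_prod _ hint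
    _ = _ := by
      refine integral_congr_ae (.of_forall fun ω => ?_)
      simp only [Measure.volumeIoiPow, ENNReal.ofReal]
      rw [integral_withDensity_eq_integral_smul,
        integral_subtype_comap measurableSet_Ioi
          fun r ↦ Real.toNNReal (r ^ (d - 1)) • F (r • (ω : E)),
        setIntegral_congr_fun measurableSet_Ioi fun r hr ↦ ?_]
      · rw [NNReal.smul_def, Real.coe_toNNReal _ (pow_nonneg hr.out.le _), smul_eq_mul]
      · exact (measurable_subtype_coe.pow_const _).real_toNNReal

theorem succ_mul_mul_pow_le {a t : ℝ} (ha : 0 ≤ a) (ht : 0 ≤ t) (n : ℕ) :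
    ((n : ℝ) + 1) * (a * t ^ n) ≤ a ^ (n + 1) + n * t ^ (n + 1) := by
  induction n with
  | zero => simp
  | succ n ih =>
    have h : 0 ≤ (a ^ (n + 1) - t ^ (n + 1)) * (a - t) := by
      rcases le_total a t with h | h
      · exact mul_nonneg_of_nonpos_of_nonpos
          (sub_nonpos.2 (pow_le_pow_left₀ ha h _)) (sub_nonpos.2 h)
      · exact mul_nonneg (sub_nonneg.2 (pow_le_pow_left₀ ht h _)) (sub_nonneg.2 h)
    have := mul_le_mul_of_nonneg_left ih ht
    push_cast
    simp only [pow_succ] at *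
    nlinarith

theorem integral_Ioi_nonneg_of_hasDerivAt_le {S : ℝ} (hS : 0 < S) {φ H H' : ℝ → ℝ}
    (hφ : ∀ r, S < r → φ r = 0) (hHS : H S = 0) (hH : ∀ r ∈ Set.Ioc 0 S, H r ≤ 0)
    (hderiv : ∀ r ∈ Set.Ioc 0 S, HasDerivAt H (H' r) r)
    (hle : ∀ r ∈ Set.Ioc 0 S, H' r ≤ φ r) :
    0 ≤ ∫ r in Set.Ioi 0, φ r := by
  by_cases hint : IntegrableOn φ (Set.Ioi 0)
  swap
  · rw [integral_undef hint]
  have hsub : ∫ r in Set.Ioi 0, φ r = ∫ r in Set.Ioc 0 S, φ r :=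
    (setIntegral_eq_of_subset_of_forall_sdiff_eq_zero measurableSet_Ioi Set.Ioc_subset_Ioi_self
      fun r hr => hφ r (not_le.1 fun h => hr.2 ⟨hr.1, h⟩))
  rw [hsub, ← intervalIntegral.integral_of_le hS.le]
  have hI : IntegrableOn φ (Set.Icc 0 S) := by
    rw [integrableOn_Icc_iff_integrableOn_Ioc]
    exact hint.mono_set Set.Ioc_subset_Ioi_self
  have hcont := intervalIntegral.continuousOn_primitive_interval_left (μ := volume) (f := φ)
    (a := 0) (b := S) (by rwa [Set.uIcc_of_le hS.le])
  rw [Set.uIcc_of_le hS.le] at hcont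
  have htend := (hcont 0 ⟨le_rfl, hS.le⟩).mono_left
    (nhdsWithin_mono 0 (Set.Ioc_subset_Icc_self (a := 0) (b := S)))
  have : (nhdsWithin (0 : ℝ) (Set.Ioc 0 S)).NeBot := by
    rw [nhdsWithin_Ioc_eq_nhdsGT hS]; infer_instance
  refine ge_of_tendsto htend ?_
  filter_upwards [self_mem_nhdsWithin] with ε hε
  have := intervalIntegral.sub_le_integral_of_hasDeriv_right_of_le hε.2
    (fun r hr => (hderiv r ⟨hε.1.trans_le hr.1, hr.2⟩).continuousAt.continuousWithinAt)
    (fun r hr => (hderiv r ⟨hε.1.trans hr.1, hr.2.le⟩).hasDerivWithinAt)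
    (hI.mono_set (Set.Icc_subset_Icc_left hε.1.le))
    (fun r hr => hle r ⟨hε.1.trans hr.1, hr.2.le⟩)
  linarith [hH ε hε]

theorem integral_Ioi_log_hardy_nonneg {n : ℕ} (hn : 1 ≤ n) {f f' : ℝ → ℝ}
    (hf : ∀ r, HasDerivAt f (f' r) r) {S B c q : ℝ} (hS : 0 < S) (hSB : S < B) (hc : 0 < c)
    (hfS : ∀ r, S ≤ r → f r = 0) (hfS' : ∀ r, S ≤ r → f' r = 0)
    {k : ℝ} (hk : k = (n : ℝ) / (n + 1)) (w : ℝ → ℝ)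
    (hw : ∀ r, w r = c * exp (-(1 / ((n : ℝ) + 1)) * (r ^ (n + 1) * q))) :
    0 ≤ ∫ r in Set.Ioi 0, r ^ n * (|f' r| ^ (n + 1) * w r +
      k ^ n * (|f r| ^ (n + 1) * (r ^ (n + 1) * q) / (r ^ (n + 1) * log (B / r) ^ n) * w r) -
      k ^ (n + 1) * (|f r| ^ (n + 1) / (r ^ (n + 1) * log (B / r) ^ (n + 1)) * w r)) := by
  have hL : ∀ r ∈ Set.Ioc 0 S, 0 < log (B / r) := fun r hr =>
    log_pos ((one_lt_div hr.1).2 (hr.2.trans_lt hSB))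
  have hk0 : 0 ≤ k := by rw [hk]; positivity
  have hwpos : ∀ r, 0 < w r := fun r => by rw [hw]; positivity
  have hp : (1 : ℝ) < (n + 1 : ℕ) := by exact_mod_cast Nat.lt_succ_of_le hn
  set D : ℝ → ℝ := fun r => ((n + 1 : ℕ) : ℝ) * |f r| ^ (((n + 1 : ℕ) : ℝ) - 2) * f r * f' r
  have hD : ∀ r, HasDerivAt (fun r => |f r| ^ (n + 1)) (D r) r := fun r => by
    have := (hasDerivAt_abs_rpow (f r) hp).comp r (hf r)
    simp only [rpow_natCast] at this
    exact this
  have hDabs : ∀ r, |D r| = (n + 1) * (|f' r| * |f r| ^ n) := fun r => by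
    rcases eq_or_ne (f r) 0 with h0 | h0
    · simp [D, h0, Nat.one_le_iff_ne_zero.1 hn]
    · have h1 : |f r| ^ (((n + 1 : ℕ) : ℝ) - 2) * |f r| = |f r| ^ n := by
        rw [← rpow_add_one (abs_ne_zero.2 h0), ← rpow_natCast]
        congr 1; push_cast; ring
      simp only [D, abs_mul, Nat.abs_cast, abs_of_nonneg (rpow_nonneg (abs_nonneg (f r)) _)]
      rw [← h1]; push_cast; ring
  have hw' : ∀ r, HasDerivAt w (-(q * r ^ n * w r)) r := fun r => by
    have h := (((hasDerivAt_pow (n + 1) r).mul_const q).const_mul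
      (-(1 / ((n : ℝ) + 1)))).exp.const_mul c
    rw [← show w = fun r => c * exp (-(1 / ((n : ℝ) + 1)) * (r ^ (n + 1) * q)) from funext hw] at h
    refine h.congr_deriv ?_
    rw [hw r]
    push_cast
    field_simp
  have hLd : ∀ r ∈ Set.Ioc 0 S, HasDerivAt (fun r => (log (B / r) ^ n)⁻¹)
      (n / (log (B / r) ^ (n + 1) * r)) r := fun r hr => by
    have hr0 : r ≠ 0 := hr.1.ne'
    have hB : B ≠ 0 := (hS.trans hSB).ne'
    have h1 : HasDerivAt (fun r => log (B / r)) (-1 / r) r := by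
      have h := ((hasDerivAt_const r B).div (hasDerivAt_id r) hr0).log (div_ne_zero hB hr0)
      refine h.congr_deriv ?_
      simp only [id, Pi.div_apply]
      field_simp
      ring
    have h2 := (h1.pow n).inv (pow_pos (hL r hr) n).ne'
    refine h2.congr_deriv ?_
    have := (hL r hr).ne'
    obtain ⟨m, rfl⟩ := Nat.exists_eq_add_of_le' hn
    simp only [Nat.add_sub_cancel, Pi.pow_apply]
    field_simp
    ring
  refine integral_Ioi_nonneg_of_hasDerivAt_le hS
    (H := fun r => -(k ^ n) * (|f r| ^ (n + 1) * w r * (log (B / r) ^ n)⁻¹)) ?_ ?_ ?_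
    (fun r hr => (((hD r).mul (hw' r)).mul (hLd r hr)).const_mul _) ?_
  · intro r hr
    simp [hfS r hr.le, hfS' r hr.le]
  · simp [hfS S le_rfl]
  · intro r hr
    have := hL r hr
    have := hwpos r
    rw [neg_mul, neg_nonpos]; positivity
  · intro r hr
    have hr0 := hr.1
    have hl := hL r hr
    have hy := succ_mul_mul_pow_le (a := r * |f' r|) (t := k * |f r| / log (B / r))
      (by positivity) (by positivity) n
    have hd : -D r ≤ (n + 1) * (|f' r| * |f r| ^ n) := (neg_le_abs _).trans_eq (hDabs r)
    have hkn : (n : ℝ) * k ^ n = (n + 1) * k ^ (n + 1) := by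
      rw [pow_succ, hk]; field_simp
    change _ * ((_ + _) * _ + (|f r| ^ (n + 1) * w r) * _) ≤ _
    set l := log (B / r)
    rw [← sub_nonneg]
    have hy' : 0 ≤ w r / r * ((r * |f' r|) ^ (n + 1) + n * (k * |f r| / l) ^ (n + 1) -
        (n + 1) * (r * |f' r| * (k * |f r| / l) ^ n)) :=
      mul_nonneg (div_nonneg (hwpos r).le hr0.le) (sub_nonneg.2 hy)
    have hd' : 0 ≤ w r * k ^ n / l ^ n * ((n + 1) * (|f' r| * |f r| ^ n) + D r) :=
      mul_nonneg (div_nonneg (mul_nonneg (hwpos r).le (by positivity)) (by positivity))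
        (by linarith)
    refine (add_nonneg hy' hd').trans_eq ?_
    have hk2 : (n : ℝ) * k ^ (n + 1) = n * k ^ n - k ^ (n + 1) := by rw [hkn]; ring
    simp only [mul_pow, div_pow]
    rw [mul_div_assoc, mul_div_assoc, ← mul_assoc (n : ℝ), hk2]
    field_simp
    ring

section QuadraticForm

variable {N : ℕ} (A : Matrix (Fin N) (Fin N) ℝ)

theorem sum_sum_mul_nonneg_of_posSemidef (hA : A.PosSemidef) (x : EuclideanSpace ℝ (Fin N)) :
    0 ≤ ∑ i, ∑ j, A i j * x i * x j := by
  have h := hA.dotProduct_mulVec_nonneg x.ofLp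
  simp only [dotProduct, Matrix.mulVec, Finset.mul_sum, star_trivial] at h
  refine h.trans_eq (Finset.sum_congr rfl fun i _ => Finset.sum_congr rfl fun j _ => ?_)
  ring

theorem sum_sum_mul_smul (r : ℝ) (x : EuclideanSpace ℝ (Fin N)) :
    ∑ i, ∑ j, A i j * (r • x) i * (r • x) j = r ^ 2 * ∑ i, ∑ j, A i j * x i * x j := by
  simp only [Finset.mul_sum, PiLp.smul_apply, smul_eq_mul]
  exact Finset.sum_congr rfl fun i _ => Finset.sum_congr rfl fun j _ => by ring

theorem sum_sum_mul_le (x : EuclideanSpace ℝ (Fin N)) :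
    ∑ i, ∑ j, A i j * x i * x j ≤ (∑ i, ∑ j, |A i j|) * ‖x‖ ^ 2 := by
  simp only [Finset.sum_mul]
  refine Finset.sum_le_sum fun i _ => Finset.sum_le_sum fun j _ => (le_abs_self _).trans ?_
  have hx : ∀ i, |x i| ≤ ‖x‖ := fun i => PiLp.norm_apply_le x i
  rw [abs_mul, abs_mul, mul_assoc, sq]
  gcongr
  exacts [hx i, hx j]

theorem sq_rpow_half {r : ℝ} (hr : 0 ≤ r) (N : ℕ) : (r ^ 2) ^ ((N : ℝ) / 2) = r ^ N := by
  rw [← rpow_natCast r 2, ← rpow_mul hr, ← rpow_natCast r N]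
  congr 1
  push_cast
  ring

end QuadraticForm

theorem stmt_0 (N : ℕ) (hN : 2 ≤ N)
    (Ω : Set (EuclideanSpace ℝ (Fin N))) (hΩopen : IsOpen Ω) (hΩconn : IsConnected Ω)
    (hΩbdd : Bornology.IsBounded Ω)
    (R : ℝ) (hR : R = sSup ((fun x => ‖x‖) '' Ω))
    (a : ℝ) (ha : 1 ≤ a)
    (A : Matrix (Fin N) (Fin N) ℝ) (hAsymm : A.IsSymm) (hA : A.PosSemidef)
    (c : ℝ) (hc : 0 < c)
    (ρ : EuclideanSpace ℝ (Fin N) → ℝ)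
    (hρ : ∀ x, ρ x = c * Real.exp (-(1 / (N : ℝ)) *
      (∑ i, ∑ j, A i j * x i * x j) ^ ((N : ℝ) / 2)))
    (u : EuclideanSpace ℝ (Fin N) → ℝ)
    (hu : ContDiff ℝ 1 u) (husupp : HasCompactSupport u) (huΩ : tsupport u ⊆ Ω) :
    (((N : ℝ) - 1) / N) ^ N *
      ∫ x in Ω, |u x| ^ N / (‖x‖ ^ N * (Real.log (a * R / ‖x‖)) ^ N) * ρ x ≤
    (∫ x in Ω, |fderiv ℝ u x ((‖x‖)⁻¹ • x)| ^ N * ρ x) +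
    (((N : ℝ) - 1) / N) ^ (N - 1) *
      ∫ x in Ω, |u x| ^ N * (∑ i, ∑ j, A i j * x i * x j) ^ ((N : ℝ) / 2) /
        (‖x‖ ^ N * (Real.log (a * R / ‖x‖)) ^ (N - 1)) * ρ x := by
  obtain ⟨n, rfl⟩ : ∃ n, N = n + 1 := Nat.exists_eq_add_of_le' (by lia)
  have hn : 1 ≤ n := by lia
  set Q : EuclideanSpace ℝ (Fin (n + 1)) → ℝ := fun x => ∑ i, ∑ j, A i j * x i * x j
  have hQ0 : ∀ x, 0 ≤ Q x := sum_sum_mul_nonneg_of_posSemidef A hA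
  have hQcont : Continuous Q := by fun_prop
  have hNpos : (0 : ℝ) ≤ ((n + 1 : ℕ) : ℝ) / 2 := by positivity
  set P : EuclideanSpace ℝ (Fin (n + 1)) → ℝ := fun x => Q x ^ (((n + 1 : ℕ) : ℝ) / 2)
  have hP0 : ∀ x, 0 ≤ P x := fun x => rpow_nonneg (hQ0 x) _
  have hPcont : Continuous P := hQcont.rpow_const fun _ => Or.inr hNpos
  have hPsmul : ∀ r, 0 ≤ r → ∀ x, P (r • x) = r ^ (n + 1) * P x := fun r hr x => by
    simp only [P, Q]
    rw [sum_sum_mul_smul, mul_rpow (sq_nonneg r) (hQ0 x), sq_rpow_half hr]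
  set C : ℝ := (∑ i, ∑ j, |A i j|) ^ (((n + 1 : ℕ) : ℝ) / 2)
  have hPle : ∀ x, P x ≤ C * ‖x‖ ^ (n + 1) := fun x => by
    refine (rpow_le_rpow (hQ0 x) (sum_sum_mul_le A x) hNpos).trans_eq ?_
    rw [mul_rpow (by positivity) (by positivity), sq_rpow_half (norm_nonneg x)]
  have hρ' : ∀ x, ρ x = c * exp (-(1 / ((n + 1 : ℕ) : ℝ)) * P x) := hρ
  have hρ0 : ∀ x, 0 ≤ ρ x := fun x => by rw [hρ']; positivity
  have hρle : ∀ x, ρ x ≤ c := fun x => by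
    rw [hρ']
    refine mul_le_of_le_one_right hc.le (exp_le_one_iff.2 ?_)
    rw [neg_mul, neg_nonpos]
    exact mul_nonneg (by positivity) (hP0 x)
  have hρcont : Continuous ρ := by
    rw [funext hρ']
    fun_prop
  have hΩR : Ω ⊆ Metric.ball 0 R := by
    rw [← interior_closedBall']
    refine hΩopen.subset_interior_iff.2 fun x hx => ?_
    rw [mem_closedBall_zero_iff, hR]
    obtain ⟨M, hM⟩ := hΩbdd.exists_norm_le
    exact le_csSup ⟨M, Set.forall_mem_image.2 hM⟩ (Set.mem_image_of_mem _ hx)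
  have hR0 : 0 < R := by
    obtain ⟨x, hx⟩ := hΩconn.nonempty
    exact (norm_nonneg x).trans_lt (mem_ball_zero_iff.1 (hΩR hx))
  obtain ⟨S, ⟨hS, hSR⟩, hSu⟩ := exists_pos_lt_subset_ball hR0 (isClosed_tsupport u)
    (huΩ.trans hΩR)
  have hSB : S < a * R := hSR.trans_le (le_mul_of_one_le_left hR0.le ha)
  have hlog0 : 0 < log (a * R / S) := log_pos ((one_lt_div hS).2 hSB)
  have hlog : ∀ x ∈ tsupport u, x ≠ 0 → log (a * R / S) ≤ log (a * R / ‖x‖) := fun x hx hx0 => by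
    have := norm_pos_iff.2 hx0
    have := mem_ball_zero_iff.1 (hSu hx)
    have : 0 < a * R := hS.trans hSB
    gcongr
  have hu0 : ∀ x, x ∉ tsupport u → u x = 0 := fun x hx => image_eq_zero_of_notMem_tsupport hx
  have hdu0 : ∀ x, x ∉ tsupport u → fderiv ℝ u x = 0 := fun x hx =>
    image_eq_zero_of_notMem_tsupport fun h => hx (tsupport_fderiv_subset ℝ h)
  have hducont : Continuous (fderiv ℝ u) := hu.continuous_fderiv (by simp)
  set k : ℝ := (((n + 1 : ℕ) : ℝ) - 1) / (n + 1 : ℕ) with hk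
  have hk' : k = (n : ℝ) / (n + 1) := by rw [hk]; push_cast; rw [add_sub_cancel_right]
  have hk0 : 0 ≤ k := by rw [hk']; positivity
  change k ^ (n + 1) * ∫ x in Ω, |u x| ^ (n + 1) /
      (‖x‖ ^ (n + 1) * (log (a * R / ‖x‖)) ^ (n + 1)) * ρ x ≤
    (∫ x in Ω, |fderiv ℝ u x ((‖x‖)⁻¹ • x)| ^ (n + 1) * ρ x) + k ^ n *
      ∫ x in Ω, |u x| ^ (n + 1) * P x / (‖x‖ ^ (n + 1) * (log (a * R / ‖x‖)) ^ n) * ρ x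
  have hΩzero : ∀ x, x ∉ Ω → x ∉ tsupport u := fun x hx h => hx (huΩ h)
  rw [setIntegral_eq_integral_of_forall_compl_eq_zero fun x hx => by
      simp [hu0 x (hΩzero x hx)],
    setIntegral_eq_integral_of_forall_compl_eq_zero fun x hx => by
      simp [hdu0 x (hΩzero x hx)],
    setIntegral_eq_integral_of_forall_compl_eq_zero fun x hx => by
      simp [hu0 x (hΩzero x hx)]]
  set T₁ : EuclideanSpace ℝ (Fin (n + 1)) → ℝ := fun x =>
    |u x| ^ (n + 1) / (‖x‖ ^ (n + 1) * (log (a * R / ‖x‖)) ^ (n + 1)) * ρ x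
  set T₂ : EuclideanSpace ℝ (Fin (n + 1)) → ℝ := fun x =>
    |fderiv ℝ u x ((‖x‖)⁻¹ • x)| ^ (n + 1) * ρ x
  set T₃ : EuclideanSpace ℝ (Fin (n + 1)) → ℝ := fun x =>
    |u x| ^ (n + 1) * P x / (‖x‖ ^ (n + 1) * (log (a * R / ‖x‖)) ^ n) * ρ x
  have hT₂0 : ∀ x, 0 ≤ T₂ x := fun x => mul_nonneg (by positivity) (hρ0 x)
  have hT₃0 : ∀ x, 0 ≤ T₃ x := fun x => by
    by_cases hx : x ∈ tsupport u
    · rcases eq_or_ne x 0 with rfl | hx0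
      · simp [T₃]
      · have := hlog0.trans_le (hlog x hx hx0)
        have := hP0 x
        have := hρ0 x
        positivity
    · simp [T₃, hu0 x hx]
  by_cases hT₁int : Integrable T₁
  swap
  · rw [integral_undef hT₁int, mul_zero]
    exact add_nonneg (integral_nonneg hT₂0)
      (mul_nonneg (pow_nonneg hk0 n) (integral_nonneg hT₃0))
  have hT₂int : Integrable T₂ := by
    have hcs : HasCompactSupport fun x => ‖fderiv ℝ u x‖ ^ (n + 1) * c :=
      (husupp.fderiv ℝ).mono fun x hx h => hx (by simp [h])
    refine Integrable.mono' (Continuous.integrable_of_hasCompactSupport (by fun_prop) hcs) ?_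
      (.of_forall fun x => ?_)
    · have h : Measurable fun x : EuclideanSpace ℝ (Fin (n + 1)) =>
          fderiv ℝ u x ((‖x‖)⁻¹ • x) :=
        isBoundedBilinearMap_apply.continuous.measurable.comp
          (hducont.measurable.prodMk (by fun_prop))
      have := hρcont.measurable
      exact Measurable.aestronglyMeasurable (by fun_prop)
    · rw [Real.norm_of_nonneg (hT₂0 x)]
      have h1 : ‖(‖x‖)⁻¹ • x‖ ≤ 1 := by
        rw [norm_smul, norm_inv, norm_norm]
        exact inv_mul_le_one
      have h2 : |fderiv ℝ u x ((‖x‖)⁻¹ • x)| ≤ ‖fderiv ℝ u x‖ :=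
        (fderiv ℝ u x).unit_le_opNorm _ h1
      have := hρ0 x
      have := hρle x
      simp only [T₂]
      gcongr
  have hT₃int : Integrable T₃ := by
    have hucont := hu.continuous
    have hcs : HasCompactSupport fun x => |u x| ^ (n + 1) * (C / log (a * R / S) ^ n * c) :=
      husupp.mono fun x hx h => hx (by simp [h])
    refine Integrable.mono' (Continuous.integrable_of_hasCompactSupport (by fun_prop) hcs) ?_
      (.of_forall fun x => ?_)
    · have := hρcont.measurable
      have := hPcont.measurable
      have := hucont.measurable
      exact Measurable.aestronglyMeasurable (by fun_prop)
    · rw [Real.norm_of_nonneg (hT₃0 x)]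
      by_cases hx : x ∈ tsupport u
      swap
      · simp [T₃, hu0 x hx]
      have hC : 0 ≤ C := by positivity
      rcases eq_or_ne x 0 with rfl | hx0
      · simp only [T₃, norm_zero]
        rw [zero_pow (Nat.succ_ne_zero n), zero_mul, div_zero, zero_mul]
        positivity
      have hxn := norm_pos_iff.2 hx0
      have hl := hlog x hx hx0
      calc T₃ x = |u x| ^ (n + 1) * (P x / ‖x‖ ^ (n + 1) / log (a * R / ‖x‖) ^ n * ρ x) := by
            simp only [T₃]; rw [mul_div_assoc, div_div, mul_assoc]
        _ ≤ _ := by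
          have := hρ0 x
          have := hρle x
          have : P x / ‖x‖ ^ (n + 1) ≤ C := (div_le_iff₀ (by positivity)).2 (hPle x)
          gcongr
  have hT₂₃int : Integrable fun x => T₂ x + k ^ n * T₃ x := hT₂int.add (hT₃int.const_mul _)
  have hF : Integrable fun x => T₂ x + k ^ n * T₃ x - k ^ (n + 1) * T₁ x :=
    hT₂₃int.sub (hT₁int.const_mul _)
  have hkey : 0 ≤ ∫ x, (T₂ x + k ^ n * T₃ x - k ^ (n + 1) * T₁ x) := by
    rw [integral_eq_integral_sphere_integral_Ioi volume hF]
    refine integral_nonneg fun ω => ?_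
    have hω : ‖(ω : EuclideanSpace ℝ (Fin (n + 1)))‖ = 1 := norm_eq_of_mem_sphere ω
    have hout : ∀ r, S ≤ r → r • (ω : EuclideanSpace ℝ (Fin (n + 1))) ∉ tsupport u :=
      fun r hr h => by
        have := mem_ball_zero_iff.1 (hSu h)
        rw [norm_smul, hω, mul_one, norm_of_nonneg (hS.le.trans hr)] at this
        exact this.not_ge hr
    have hf : ∀ r : ℝ, HasDerivAt (fun r : ℝ => u (r • (ω : EuclideanSpace ℝ (Fin (n + 1)))))
        (fderiv ℝ u (r • (ω : EuclideanSpace ℝ (Fin (n + 1)))) ω) r := fun r => by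
      have h := (hasDerivAt_id r).smul_const (ω : EuclideanSpace ℝ (Fin (n + 1)))
      rw [one_smul] at h
      exact ((hu.differentiable (by simp)) _).hasFDerivAt.comp_hasDerivAt r h
    refine (integral_Ioi_log_hardy_nonneg hn hf hS hSB hc (fun r hr => hu0 _ (hout r hr))
      (fun r hr => by rw [hdu0 _ (hout r hr)]; rfl) hk'
      (q := P ω) _ fun r => rfl).trans_eq (setIntegral_congr_fun measurableSet_Ioi fun r hr => ?_)
    have hr' : 0 < r := hr
    have hnorm : ‖r • (ω : EuclideanSpace ℝ (Fin (n + 1)))‖ = r := by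
      rw [norm_smul, hω, mul_one, norm_of_nonneg hr'.le]
    simp only [T₁, T₂, T₃, hρ', hnorm, hPsmul r hr'.le, finrank_euclideanSpace_fin,
      Nat.add_sub_cancel, inv_smul_smul₀ hr'.ne', Nat.cast_add, Nat.cast_one]
  rw [integral_sub hT₂₃int (hT₁int.const_mul _),
    integral_add hT₂int (hT₃int.const_mul _), integral_const_mul, integral_const_mul] at hkey
  linarith
end

section
/- Let 1 < p < ∞, A a real N×N symmetric positive semi-definite matrix, ρ_A(x) = c·exp(−(1/p)(xᵀAx)^{p/2}) on the half space ℝ^N_+ = {x = (x', x_N) : x_N > 0}, and dμ_A = ρ_A dx. Then for every u ∈ C_c^1(ℝ^N_+): ((p−1)/p)^p ∫_{ℝ^N_+} |u|^p / x_N^p dμ_A ≤ ∫_{ℝ^N_+} |∂u/∂x_N|^p dμ_A − ((p−1)/p)^{p−1} ∫_{ℝ^N_+} |u|^p (xᵀAx)^{(p−2)/2} (Ax)_N / x_N^{p−1} dμ_A. -/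
open MeasureTheory Real

lemma young_rpow_sub_one {p X Y : ℝ} (hp : 1 < p) (hX : 0 ≤ X) (hY : 0 ≤ Y) :
    p * (X ^ (p - 1) * Y) ≤ Y ^ p + (p - 1) * X ^ p := by
  have hpq : p.HolderConjugate (p / (p - 1)) := Real.HolderConjugate.conjExponent hp
  have h := Real.young_inequality_of_nonneg hY (rpow_nonneg hX (p - 1)) hpq
  have hp1 : p - 1 ≠ 0 := by linarith
  have hp0 : p ≠ 0 := by linarith
  rw [← rpow_mul hX, mul_div_cancel₀ _ hp1] at h
  calc p * (X ^ (p - 1) * Y) = p * (Y * X ^ (p - 1)) := by ring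
    _ ≤ p * (Y ^ p / p + X ^ p / (p / (p - 1))) := by gcongr
    _ = _ := by field_simp

lemma abs_rpow_sub_two_mul_self {p : ℝ} (hp : 1 < p) (y : ℝ) :
    |(|y| ^ (p - 2) * y)| = |y| ^ (p - 1) := by
  rcases eq_or_ne y 0 with rfl | hy
  · simp [zero_rpow (by linarith : p - 1 ≠ 0)]
  · rw [abs_mul, abs_of_nonneg (rpow_nonneg (abs_nonneg y) _),
      ← rpow_add_one (abs_ne_zero.2 hy)]
    ring_nf

lemma integrable_of_abs_le_continuousOn {E : Type*} [TopologicalSpace E] [T2Space E]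
    [MeasurableSpace E] [BorelSpace E] {μ : Measure E} [IsFiniteMeasureOnCompacts μ]
    {K : Set E} (hK : IsCompact K) {f g : E → ℝ} (hf : Measurable f) (hg : ContinuousOn g K)
    (hfK : ∀ x ∉ K, f x = 0) (hfg : ∀ x ∈ K, |f x| ≤ g x) : Integrable f μ := by
  have hsupp : Function.support f ⊆ K := fun x hx ↦ by
    by_contra h
    exact hx (hfK x h)
  rw [← integrableOn_iff_integrable_of_support_subset hsupp]
  refine (hg.integrableOn_compact' hK hK.measurableSet).mono' hf.aestronglyMeasurable ?_
  exact (ae_restrict_iff' hK.measurableSet).2 (.of_forall hfg)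

/-- A Hardy inequality in the `i`-th direction with respect to the weight `ρ`, whose logarithmic
derivative in that direction is `-w`. -/
theorem hardy_inequality_weighted {ι : Type*} [Fintype ι] [DecidableEq ι] (i : ι) {p : ℝ}
    (hp : 1 < p) {ρ w B : EuclideanSpace ℝ ι → ℝ} (hρ : Continuous ρ) (hρ0 : ∀ x, 0 ≤ ρ x)
    (hw : Measurable w) (hB : Continuous B) (hwB : ∀ x, |w x| ≤ B x)
    (hρw : ∀ x, HasLineDerivAt ℝ ρ (-(w x * ρ x)) x (EuclideanSpace.single i 1))
    {u : EuclideanSpace ℝ ι → ℝ} (hu : ContDiff ℝ 1 u) (hsupp : HasCompactSupport u)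
    (huH : tsupport u ⊆ {x | 0 < x i}) :
    ((p - 1) / p) ^ p * ∫ x in {x | 0 < x i}, |u x| ^ p / x i ^ p * ρ x ≤
      (∫ x in {x | 0 < x i}, |fderiv ℝ u x (EuclideanSpace.single i 1)| ^ p * ρ x) -
      ((p - 1) / p) ^ (p - 1) *
        ∫ x in {x | 0 < x i}, |u x| ^ p * w x / x i ^ (p - 1) * ρ x := by
  set e : EuclideanSpace ℝ ι := EuclideanSpace.single i 1 with he
  set a := (p - 1) / p with ha
  have hp0 : 0 < p := by linarith
  have ha0 : 0 < a := div_pos (by linarith) hp0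
  have hu0 : ∀ x ∉ tsupport u, u x = 0 := fun x hx ↦ image_eq_zero_of_notMem_tsupport hx
  have hdu0 : ∀ x ∉ tsupport u, fderiv ℝ u x e = 0 := fun x hx ↦ by
    rw [Function.notMem_support.1 fun h ↦ hx (support_fderiv_subset ℝ h)]
    simp
  have hpos : ∀ x ∈ tsupport u, 0 < x i := fun x hx ↦ huH hx
  have huc : Continuous u := hu.continuous
  have hduc : Continuous fun x ↦ fderiv ℝ u x e :=
    (hu.continuous_fderiv one_ne_zero).clm_apply continuous_const
  have hxc : Continuous fun x : EuclideanSpace ℝ ι ↦ x i := by fun_prop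
  have hupc : Continuous fun x ↦ |u x| ^ p := huc.abs.rpow_const fun x ↦ .inr hp0.le
  have hup1c : Continuous fun x ↦ |u x| ^ (p - 1) :=
    huc.abs.rpow_const fun x ↦ .inr (by linarith)
  have htc : ∀ r : ℝ, ContinuousOn (fun x : EuclideanSpace ℝ ι ↦ x i ^ r) (tsupport u) :=
    fun r ↦ hxc.continuousOn.rpow_const fun x hx ↦ .inl (hpos x hx).ne'
  have ht0 : ∀ r : ℝ, ∀ x ∈ tsupport u, x i ^ r ≠ 0 :=
    fun r x hx ↦ (rpow_pos_of_pos (hpos x hx) r).ne'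
  have hxm := hxc.measurable
  have hum := huc.measurable
  have hdum := hduc.measurable
  have hρm := hρ.measurable
  set I : EuclideanSpace ℝ ι → ℝ := fun x ↦ |u x| ^ p / x i ^ p * ρ x with hI
  set J : EuclideanSpace ℝ ι → ℝ := fun x ↦ |u x| ^ p * w x / x i ^ (p - 1) * ρ x with hJ
  set D : EuclideanSpace ℝ ι → ℝ := fun x ↦ |fderiv ℝ u x e| ^ p * ρ x with hD
  set F : EuclideanSpace ℝ ι → ℝ :=
    fun x ↦ (fderiv ℝ u x e * (p * |u x| ^ (p - 2) * u x)) * (x i ^ (1 - p) * ρ x) with hF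
  have hI0 : ∀ x ∉ tsupport u, I x = 0 := fun x hx ↦ by
    simp [hI, hu0 x hx, zero_rpow hp0.ne']
  have hJ0 : ∀ x ∉ tsupport u, J x = 0 := fun x hx ↦ by
    simp [hJ, hu0 x hx, zero_rpow hp0.ne']
  have hD0 : ∀ x ∉ tsupport u, D x = 0 := fun x hx ↦ by
    simp [hD, hdu0 x hx, zero_rpow hp0.ne']
  have hF0 : ∀ x ∉ tsupport u, F x = 0 := fun x hx ↦ by simp [hF, hu0 x hx]
  have hFabs : ∀ x ∈ tsupport u,
      |F x| = p * (|u x| ^ (p - 1) * |fderiv ℝ u x e|) * (x i ^ (1 - p) * ρ x) := fun x hx ↦ by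
    have h := abs_rpow_sub_two_mul_self hp (u x)
    have : F x = p * (|u x| ^ (p - 2) * u x * fderiv ℝ u x e) * (x i ^ (1 - p) * ρ x) := by
      simp only [hF]; ring
    rw [this, abs_mul, abs_mul, abs_mul _ (fderiv ℝ u x e), h, abs_of_pos hp0,
      abs_of_nonneg (mul_nonneg (rpow_nonneg (hpos x hx).le _) (hρ0 x))]
  have hIi : Integrable I := by
    refine integrable_of_abs_le_continuousOn (g := I) hsupp (by fun_prop) ?_ hI0 fun x hx ↦ ?_
    · exact (hupc.continuousOn.div (htc p) (ht0 p)).mul hρ.continuousOn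
    · exact (abs_of_nonneg (mul_nonneg (div_nonneg (rpow_nonneg (abs_nonneg _) _)
        (rpow_nonneg (hpos x hx).le _)) (hρ0 x))).le
  have hJi : Integrable J := by
    refine integrable_of_abs_le_continuousOn
      (g := fun x ↦ |u x| ^ p * B x / x i ^ (p - 1) * ρ x) hsupp (by fun_prop) ?_ hJ0
      fun x hx ↦ ?_
    · exact ((hupc.mul hB).continuousOn.div (htc _) (ht0 _)).mul hρ.continuousOn
    · have h1 := rpow_pos_of_pos (hpos x hx) (p - 1)
      have h2 := rpow_nonneg (abs_nonneg (u x)) p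
      simp only [hJ]
      rw [abs_mul, abs_div, abs_mul, abs_of_nonneg h2, abs_of_pos h1, abs_of_nonneg (hρ0 x)]
      have := hρ0 x
      have := hwB x
      gcongr
  have hDi : Integrable D := by
    refine integrable_of_abs_le_continuousOn (g := D) hsupp (by fun_prop) ?_ hD0 fun x hx ↦ ?_
    · exact ((hduc.abs.rpow_const fun x ↦ .inr hp0.le).mul hρ).continuousOn
    · exact (abs_of_nonneg (mul_nonneg (rpow_nonneg (abs_nonneg _) _) (hρ0 x))).le
  have hFi : Integrable F := by
    refine integrable_of_abs_le_continuousOn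
      (g := fun x ↦ p * (|u x| ^ (p - 1) * |fderiv ℝ u x e|) * (x i ^ (1 - p) * ρ x))
      hsupp (by fun_prop) ?_ hF0 fun x hx ↦ (hFabs x hx).le
    exact ((hup1c.mul hduc.abs).const_mul p).continuousOn.mul ((htc _).mul hρ.continuousOn)
  have hIJ : ∀ x, |u x| ^ p * ((1 - p) * x i ^ (-p) * ρ x + x i ^ (1 - p) * (-(w x * ρ x)))
      = (1 - p) * I x - J x := fun x ↦ by
    by_cases hx : x ∈ tsupport u
    · have h1 : x i ^ (1 - p) = (x i ^ (p - 1))⁻¹ := by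
        rw [← rpow_neg (hpos x hx).le, neg_sub]
      simp only [hI, hJ, h1, rpow_neg (hpos x hx).le, div_eq_mul_inv]
      ring
    · rw [hI0 x hx, hJ0 x hx, hu0 x hx, abs_zero, zero_rpow hp0.ne']
      ring
  have hparts : (1 - p) * (∫ x, I x) - (∫ x, J x) = - ∫ x, F x := by
    have hfg : Integrable fun x ↦ |u x| ^ p * (x i ^ (1 - p) * ρ x) := by
      refine integrable_of_abs_le_continuousOn
        (g := fun x ↦ |u x| ^ p * (x i ^ (1 - p) * ρ x)) hsupp (by fun_prop) ?_
        (fun x hx ↦ by simp [hu0 x hx, zero_rpow hp0.ne']) fun x hx ↦ ?_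
      · exact hupc.continuousOn.mul ((htc _).mul hρ.continuousOn)
      · exact (abs_of_nonneg (mul_nonneg (rpow_nonneg (abs_nonneg _) _)
          (mul_nonneg (rpow_nonneg (hpos x hx).le _) (hρ0 x)))).le
    have key := integral_bilinear_hasLineDerivAt_right_eq_neg_left_of_integrable
      (μ := (volume : Measure (EuclideanSpace ℝ ι))) (B := ContinuousLinearMap.mul ℝ ℝ)
      (f := fun x ↦ |u x| ^ p) (f' := fun x ↦ fderiv ℝ u x e * (p * |u x| ^ (p - 2) * u x))
      (g := fun x ↦ x i ^ (1 - p) * ρ x) (v := e)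
      (g' := fun x ↦ (1 - p) * x i ^ (-p) * ρ x + x i ^ (1 - p) * (-(w x * ρ x)))
      hFi (by
        simp only [ContinuousLinearMap.mul_apply', hIJ]
        exact (hIi.const_mul (1 - p)).sub hJi) hfg ?_ ?_
    · simp only [ContinuousLinearMap.mul_apply', hIJ] at key
      rw [integral_sub (hIi.const_mul _) hJi, integral_const_mul] at key
      exact key
    · intro x _
      have h1 : HasLineDerivAt ℝ u (fderiv ℝ u x e) x e :=
        ((hu.differentiable one_ne_zero) x).hasFDerivAt.hasLineDerivAt e
      have h2 := hasDerivAt_abs_rpow (u x) hp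
      have h3 : HasDerivAt (fun y : ℝ ↦ |y| ^ p) (p * |u x| ^ (p - 2) * u x)
        (u (x + (0 : ℝ) • e)) := by simpa using h2
      have := HasDerivAt.comp (0 : ℝ) h3 h1
      rw [mul_comm] at this
      exact this
    · intro x hx
      have hx' : x ∈ tsupport u := by
        refine closure_mono (fun y hy h ↦ ?_) hx
        exact hy (by simp [h, zero_rpow hp0.ne'])
      have h1 : HasDerivAt (fun s : ℝ ↦ (x + s • e) i) 1 0 := by
        have : (fun s : ℝ ↦ (x + s • e) i) = fun s ↦ x i + s := by
          ext s; simp [he]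
        rw [this]
        exact (hasDerivAt_id _).const_add _
      have h2 := (h1.rpow_const (p := 1 - p) (.inl (by simpa using (hpos x hx').ne'))).mul (hρw x)
      have h3 : (1 - p - 1) = -p := by ring
      simp only [zero_smul, add_zero, one_mul, h3] at h2
      exact h2
  have hpt : ∀ x, a ^ (p - 1) * F x ≤ D x + (p - 1) * a ^ p * I x := fun x ↦ by
    by_cases hx : x ∈ tsupport u
    · have ht := hpos x hx
      have hy := young_rpow_sub_one hp (X := a * (|u x| / x i)) (Y := |fderiv ℝ u x e|)
        (by positivity) (abs_nonneg _)
      rw [mul_rpow ha0.le (by positivity), mul_rpow ha0.le (by positivity),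
        div_rpow (abs_nonneg _) ht.le, div_rpow (abs_nonneg _) ht.le] at hy
      have h1 : x i ^ (1 - p) = (x i ^ (p - 1))⁻¹ := by
        rw [← rpow_neg ht.le, neg_sub]
      calc a ^ (p - 1) * F x ≤ a ^ (p - 1) * |F x| := by
            gcongr; exact le_abs_self _
        _ = p * (a ^ (p - 1) * (|u x| ^ (p - 1) / x i ^ (p - 1)) * |fderiv ℝ u x e|) * ρ x := by
            rw [hFabs x hx, h1]; ring
        _ ≤ (|fderiv ℝ u x e| ^ p + (p - 1) * (a ^ p * (|u x| ^ p / x i ^ p))) * ρ x :=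
            mul_le_mul_of_nonneg_right hy (hρ0 x)
        _ = _ := by simp only [hD, hI]; ring
    · simp [hF0 x hx, hD0 x hx, hI0 x hx]
  have hint := integral_mono (hFi.const_mul (a ^ (p - 1)))
    (hDi.add (hIi.const_mul ((p - 1) * a ^ p))) hpt
  simp only [Pi.add_apply] at hint
  rw [integral_add hDi (hIi.const_mul _), integral_const_mul, integral_const_mul] at hint
  have hout : ∀ x ∉ {x : EuclideanSpace ℝ ι | 0 < x i}, x ∉ tsupport u :=
    fun x hx h ↦ hx (huH h)
  rw [setIntegral_eq_integral_of_forall_compl_eq_zero fun x hx ↦ hI0 x (hout x hx),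
    setIntegral_eq_integral_of_forall_compl_eq_zero fun x hx ↦ hJ0 x (hout x hx),
    setIntegral_eq_integral_of_forall_compl_eq_zero fun x hx ↦ hD0 x (hout x hx)]
  have hap : a ^ p = a ^ (p - 1) * a := by
    rw [← rpow_add_one ha0.ne', sub_add_cancel]
  have hpa : p * a = p - 1 := by rw [ha]; field_simp
  have hFeq : ∫ x, F x = (p - 1) * (∫ x, I x) + (∫ x, J x) := by linarith
  rw [hFeq, hap] at hint
  rw [hap]
  have : a ^ (p - 1) * (p * a) * ∫ x, I x = a ^ (p - 1) * (p - 1) * ∫ x, I x := by rw [hpa]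
  linarith

lemma hasDerivAt_quadratic_rpow {a b c p : ℝ} (hp : 1 < p) (ha : 0 ≤ a) (hb : b ^ 2 ≤ a * c) :
    HasDerivAt (fun s : ℝ ↦ (a * s ^ 2 + 2 * b * s + c) ^ (p / 2))
      (p * (c ^ ((p - 2) / 2) * b)) 0 := by
  rcases eq_or_ne c 0 with rfl | hc
  · have hb0 : b = 0 := by simpa [sq_nonpos_iff] using hb
    have hfun : (fun s : ℝ ↦ (a * s ^ 2 + 2 * b * s + 0) ^ (p / 2)) =
        fun s ↦ a ^ (p / 2) * |s| ^ p := by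
      ext s
      rw [hb0, mul_zero, zero_mul, add_zero, add_zero, mul_rpow ha (sq_nonneg s), ← sq_abs,
        ← rpow_natCast, ← rpow_mul (abs_nonneg s)]
      congr 2
      push_cast
      ring
    rw [hfun]
    simpa [hb0] using (hasDerivAt_abs_rpow 0 hp).const_mul (a ^ (p / 2))
  · have h1 : HasDerivAt (fun s : ℝ ↦ a * s ^ 2 + 2 * b * s + c) (2 * b) 0 := by
      have := ((((hasDerivAt_id (0 : ℝ)).pow 2).const_mul a).add
        ((hasDerivAt_id (0 : ℝ)).const_mul (2 * b))).add_const c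
      simpa using this
    convert h1.rpow_const (p := p / 2) (.inl (by simpa using hc)) using 1
    have : p / 2 - 1 = (p - 2) / 2 := by ring
    rw [this]
    simp
    ring

namespace Matrix

variable {ι : Type*} [Fintype ι]

lemma sum_sum_mul_eq_dotProduct_mulVec (A : Matrix ι ι ℝ) (x : ι → ℝ) :
    ∑ i, ∑ j, A i j * x i * x j = x ⬝ᵥ A *ᵥ x := by
  simp only [dotProduct, mulVec, Finset.mul_sum]
  exact Finset.sum_congr rfl fun i _ ↦ Finset.sum_congr rfl fun j _ ↦ by ring

lemma IsSymm.dotProduct_mulVec_add_smul_single [DecidableEq ι] {A : Matrix ι ι ℝ}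
    (hA : A.IsSymm) (x : ι → ℝ) (i : ι) (s : ℝ) :
    (x + s • Pi.single i 1) ⬝ᵥ A *ᵥ (x + s • Pi.single i 1) =
      A i i * s ^ 2 + 2 * (A *ᵥ x) i * s + x ⬝ᵥ A *ᵥ x := by
  have h : x ⬝ᵥ A *ᵥ Pi.single i 1 = (A *ᵥ x) i := by
    rw [dotProduct_mulVec, ← mulVec_transpose, hA.eq]
    simp
  simp only [mulVec_add, mulVec_smul, dotProduct_add, add_dotProduct, dotProduct_smul,
    smul_dotProduct, h, smul_eq_mul]
  simp
  ring

lemma PosSemidef.mulVec_sq_le [DecidableEq ι] {A : Matrix ι ι ℝ} (hA : A.PosSemidef)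
    (hS : A.IsSymm) (x : ι → ℝ) (i : ι) :
    (A *ᵥ x) i ^ 2 ≤ A i i * (x ⬝ᵥ A *ᵥ x) := by
  have h := discrim_le_zero (a := A i i) (b := 2 * (A *ᵥ x) i) (c := x ⬝ᵥ A *ᵥ x) fun s ↦ by
    have := hA.dotProduct_mulVec_nonneg (x + s • Pi.single i 1)
    rw [star_trivial, hS.dotProduct_mulVec_add_smul_single, sq] at this
    exact this
  rw [discrim] at h
  linarith

end Matrix

lemma abs_rpow_mul_le_of_sq_le {a b c p : ℝ} (ha : 0 ≤ a) (hc : 0 ≤ c)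
    (hb : b ^ 2 ≤ a * c) : |c ^ ((p - 2) / 2) * b| ≤ √a * c ^ ((p - 1) / 2) := by
  rcases hc.eq_or_lt with rfl | hc
  · have hb0 : b = 0 := by simpa [sq_nonpos_iff] using hb
    rw [hb0, mul_zero, abs_zero]
    positivity
  · have h : |b| ≤ √a * √c := by
      rw [← sqrt_mul ha]
      exact abs_le_sqrt hb
    rw [abs_mul, abs_of_nonneg (rpow_nonneg hc.le _)]
    calc c ^ ((p - 2) / 2) * |b| ≤ c ^ ((p - 2) / 2) * (√a * √c) := by gcongr
      _ = √a * (c ^ ((p - 2) / 2) * c ^ (1 / 2 : ℝ)) := by rw [sqrt_eq_rpow c]; ring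
      _ = _ := by rw [← rpow_add hc]; ring_nf


theorem stmt_10 (N : ℕ) (hN : 1 ≤ N) (p : ℝ) (hp : 1 < p)
    (A : Matrix (Fin N) (Fin N) ℝ) (hAsymm : A.IsSymm) (hA : A.PosSemidef)
    (c : ℝ) (hc : 0 < c)
    (ρ : EuclideanSpace ℝ (Fin N) → ℝ)
    (hρ : ∀ x, ρ x = c * Real.exp (-(1 / p) *
      (∑ i, ∑ j, A i j * x i * x j) ^ (p / 2)))
    (H : Set (EuclideanSpace ℝ (Fin N)))
    (hH : H = {x : EuclideanSpace ℝ (Fin N) | 0 < x ⟨N - 1, by omega⟩})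
    (u : EuclideanSpace ℝ (Fin N) → ℝ)
    (hu : ContDiff ℝ 1 u) (husupp : HasCompactSupport u) (huH : tsupport u ⊆ H) :
    ((p - 1) / p) ^ p * ∫ x in H, |u x| ^ p / (x ⟨N - 1, by omega⟩) ^ p * ρ x ≤
      (∫ x in H, |fderiv ℝ u x (EuclideanSpace.single ⟨N - 1, by omega⟩ 1)| ^ p * ρ x) -
      ((p - 1) / p) ^ (p - 1) *
        ∫ x in H, |u x| ^ p * (∑ i, ∑ j, A i j * x i * x j) ^ ((p - 2) / 2) *
          (A.mulVec x ⟨N - 1, by omega⟩) / (x ⟨N - 1, by omega⟩) ^ (p - 1) * ρ x := by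
  set i : Fin N := ⟨N - 1, by omega⟩ with hi
  subst hH
  simp only [A.sum_sum_mul_eq_dotProduct_mulVec] at hρ ⊢
  set q : EuclideanSpace ℝ (Fin N) → ℝ := fun x ↦ x ⬝ᵥ A.mulVec x with hq
  have hq0 : ∀ x, 0 ≤ q x := fun x ↦ by simpa using hA.dotProduct_mulVec_nonneg x.ofLp
  have hqc : Continuous q := by
    simp only [hq, dotProduct, Matrix.mulVec]
    fun_prop
  have hAc : Continuous fun x : EuclideanSpace ℝ (Fin N) ↦ A.mulVec x i := by
    simp only [dotProduct, Matrix.mulVec]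
    fun_prop
  have haii : 0 ≤ A i i := hA.diag_nonneg
  have hcs : ∀ x : EuclideanSpace ℝ (Fin N), (A.mulVec x i) ^ 2 ≤ A i i * q x :=
    fun x ↦ hA.mulVec_sq_le hAsymm x i
  have hρfun : ρ = fun x ↦ c * Real.exp (-(1 / p) * q x ^ (p / 2)) := funext hρ
  have hρc : Continuous ρ := by
    rw [hρfun]
    exact continuous_const.mul (continuous_exp.comp
      (continuous_const.mul (hqc.rpow_const fun x ↦ .inr (by linarith))))
  have hmain := hardy_inequality_weighted i hp hρc (fun x ↦ by rw [hρ]; positivity)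
    (w := fun x ↦ q x ^ ((p - 2) / 2) * A.mulVec x i)
    (B := fun x ↦ √(A i i) * q x ^ ((p - 1) / 2))
    ((hqc.measurable.pow_const _).mul hAc.measurable)
    (continuous_const.mul (hqc.rpow_const fun x ↦ .inr (by linarith)))
    (fun x ↦ abs_rpow_mul_le_of_sq_le haii (hq0 x) (hcs x)) ?_ hu husupp huH
  · simp only [← mul_assoc] at hmain
    exact hmain
  · intro x
    have h1 := ((hasDerivAt_quadratic_rpow hp haii (hcs x)).const_mul (-(1 / p))).exp.const_mul c
    have hline : (fun s : ℝ ↦ ρ (x + s • EuclideanSpace.single i 1)) = fun s ↦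
        c * Real.exp (-(1 / p) *
          (A i i * s ^ 2 + 2 * A.mulVec x i * s + q x) ^ (p / 2)) := by
      ext s
      rw [hρ, ← hAsymm.dotProduct_mulVec_add_smul_single]
      rfl
    unfold HasLineDerivAt
    rw [hline]
    refine h1.congr_deriv ?_
    rw [hρfun]
    simp only [ne_eq, OfNat.ofNat_ne_zero, not_false_eq_true, zero_pow, mul_zero, zero_add]
    field_simp
end
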